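/- arXiv:1406.4160 — 2 statements merged into one kernel-verified Lean document; each statement's English description precedes it below -/
import Mathlib

section
/- Suppose n ≥ 2 is even and d ≥ σ_1(ω) + 1. Then t · Ψ'(t) < Ψ(t) for every real number t > 0; equivalently, the function t ↦ Ψ(t)/t is strictly decreasing on (0, ∞). -/
/-- The `k`-th elementary symmetric function of the (real values of) `ω : Fin N → ℕ`,
with `esym ω 0 = 1`. -/
noncomputable def esym {N : ℕ} (ω : Fin N → ℕ) (k : ℕ) : ℝ :=
  ∑ A ∈ Finset.powersetCard k (Finset.univ : Finset (Fin N)), ∏ i ∈ A, (ω i : ℝ)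

/-- `Ψ(t) = ∑_{j=0}^{n−1} ( ∑_{k=0}^{j} (−1)^k σ_{j−k}(ω) t^{k+1} ) (d−1)^{n−1−j}`
for weights `ω_0, …, ω_n`. -/
noncomputable def Psi (n : ℕ) (ω : Fin (n + 1) → ℕ) (d : ℤ) (t : ℝ) : ℝ :=
  ∑ j ∈ Finset.range n,
    (∑ k ∈ Finset.range (j + 1), (-1 : ℝ) ^ k * esym ω (j - k) * t ^ (k + 1)) *
      ((d : ℝ) - 1) ^ (n - 1 - j)

/-- elementary symmetric sums over a finset -/
noncomputable def esS {N : ℕ} (ω : Fin N → ℕ) (s : Finset (Fin N)) (k : ℕ) : ℝ :=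
  ∑ A ∈ Finset.powersetCard k s, ∏ i ∈ A, (ω i : ℝ)

lemma esS_nonneg {N : ℕ} (ω : Fin N → ℕ) (s : Finset (Fin N)) (k : ℕ) : 0 ≤ esS ω s k := by
  unfold esS; positivity

lemma esS_zero {N : ℕ} (ω : Fin N → ℕ) (s : Finset (Fin N)) : esS ω s 0 = 1 := by
  simp [esS]

lemma esS_insert {N : ℕ} (ω : Fin N → ℕ) (s : Finset (Fin N)) (a : Fin N) (ha : a ∉ s) (k : ℕ) :
    esS ω (insert a s) (k + 1) = esS ω s (k + 1) + ω a * esS ω s k := by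
  unfold esS
  rw [Finset.powersetCard_succ_insert ha, Finset.sum_union, Finset.sum_image, Finset.mul_sum]
  · congr 1
    refine Finset.sum_congr rfl fun A hA => ?_
    rw [Finset.prod_insert]
    exact fun h => ha ((Finset.mem_powersetCard.1 hA).1 h)
  · intro A hA B hB h
    have h1 : a ∉ A := fun h => ha ((Finset.mem_powersetCard.1 hA).1 h)
    have h2 : a ∉ B := fun h => ha ((Finset.mem_powersetCard.1 hB).1 h)
    rw [← Finset.erase_insert h1, ← Finset.erase_insert h2]
    rw [h]
  · rw [Finset.disjoint_left]
    intro A hA hB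
    obtain ⟨B, _, rfl⟩ := Finset.mem_image.1 hB
    exact ha ((Finset.mem_powersetCard.1 hA).1 (Finset.mem_insert_self _ _))

lemma esS_succ_le {N : ℕ} (ω : Fin N → ℕ) (s : Finset (Fin N)) :
    ∀ k, esS ω s (k + 1) ≤ esS ω s 1 * esS ω s k := by
  induction s using Finset.induction_on with
  | empty =>
    intro k
    have : esS ω ∅ (k + 1) = 0 := by
      unfold esS
      rw [Finset.powersetCard_eq_empty.2 (by simp)]; simp
    rw [this]
    exact mul_nonneg (esS_nonneg _ _ _) (esS_nonneg _ _ _)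
  | insert a s ha ih =>
    intro k
    cases k with
    | zero => simp [esS_zero]
    | succ k =>
      rw [esS_insert ω s a ha (k+1), esS_insert ω s a ha k]
      have h1 := esS_insert ω s a ha 0
      rw [esS_zero] at h1
      simp only [zero_add] at h1
      rw [h1]
      have := ih (k+1)
      have n1 := esS_nonneg ω s 1
      have n2 := esS_nonneg ω s k
      have n3 : (0:ℝ) ≤ ω a := by positivity
      have n4 := mul_nonneg n3 n2
      nlinarith [mul_nonneg n1 n4, mul_nonneg n3 n4]

/-- minus the derivative of `∑_{k<L} (-t)^k x^(L-1-k)` -/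
noncomputable def TT (x t : ℝ) (L : ℕ) : ℝ :=
  -∑ k ∈ Finset.range L, (-1 : ℝ) ^ k * (k * t ^ (k - 1)) * x ^ (L - 1 - k)

lemma TT_succ (x t : ℝ) (L : ℕ) :
    TT x t (L + 1) = x * TT x t L - (-1) ^ L * (L * t ^ (L - 1)) := by
  unfold TT
  rw [Finset.sum_range_succ]
  have : ∑ k ∈ Finset.range L, (-1 : ℝ) ^ k * (k * t ^ (k - 1)) * x ^ (L + 1 - 1 - k)
      = x * ∑ k ∈ Finset.range L, (-1 : ℝ) ^ k * (k * t ^ (k - 1)) * x ^ (L - 1 - k) := by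
    rw [Finset.mul_sum]
    refine Finset.sum_congr rfl fun k hk => ?_
    have := Finset.mem_range.1 hk
    rw [show L + 1 - 1 - k = (L - 1 - k) + 1 by omega]
    ring
  rw [this]
  simp
  ring

lemma TT_closed (x t : ℝ) (L : ℕ) :
    t * (x + t) ^ 2 * TT x t L = t * x ^ L + (L * x + (L - 1) * t) * (-t) ^ L := by
  induction L with
  | zero => simp [TT]
  | succ L ih =>
    rw [TT_succ]
    have h : t * ((L : ℝ) * t ^ (L - 1)) = L * t ^ L := by
      cases L with
      | zero => simp
      | succ L => simp; ring
    have h2 : (-t) ^ L = (-1) ^ L * t ^ L := by rw [← mul_pow]; simp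
    rw [pow_succ (-t) L]
    rw [h2] at *
    push_cast
    linear_combination x * ih - (x + t) ^ 2 * (-1) ^ L * h

lemma TT_pos {x t : ℝ} (hx : 0 < x) (ht : 0 < t) (r : ℕ) : 0 < TT x t (2 * r + 2) := by
  have h := TT_closed x t (2 * r + 2)
  rw [Even.neg_pow ⟨r + 1, by ring⟩] at h
  have h1 : 0 < t * (x + t) ^ 2 := by positivity
  refine pos_of_mul_pos_right (a := t * (x + t) ^ 2) ?_ h1.le
  rw [h]
  push_cast
  have : (0:ℝ) ≤ 2 * r + 2 - 1 := by linarith [(Nat.cast_nonneg r : (0:ℝ) ≤ r)]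
  positivity

lemma bern {x t : ℝ} (ht : 0 < t) (h : t ≤ x) (K : ℕ) :
    (K + 1 : ℝ) * t ^ K * (x - t) ≤ x ^ (K + 1) - t ^ (K + 1) := by
  induction K with
  | zero => simp
  | succ K ih =>
    have h1 : t ^ (K+1) ≤ x ^ (K+1) := pow_le_pow_left₀ ht.le h _
    push_cast
    have := mul_le_mul_of_nonneg_left ih ht.le
    have h2 := mul_le_mul_of_nonneg_right h1 (sub_nonneg.2 h)
    rw [pow_succ t (K+1), pow_succ x (K+1)]
    rw [pow_succ t K] at *
    nlinarith

lemma TT_pair {x t : ℝ} (hx : 0 < x) (ht : 0 < t) (r : ℕ) :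
    0 < TT x t (2 * r + 2) + x * TT x t (2 * r + 1) := by
  have h := TT_closed x t (2 * r + 2)
  have h' := TT_closed x t (2 * r + 1)
  rw [Even.neg_pow ⟨r + 1, by ring⟩] at h
  rw [Odd.neg_pow ⟨r, by ring⟩] at h'
  have h1 : 0 < t * (x + t) ^ 2 := by positivity
  refine pos_of_mul_pos_right (a := t * (x + t) ^ 2) ?_ h1.le
  have key : 0 < 2 * x ^ (2*r+2) + 2 * x * t ^ (2*r+1)
      - (2 * r + 1) * t ^ (2*r) * (x^2 - t^2) := by
    rcases le_total t x with hc | hc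
    · have hb := bern ht hc (2*r)
      push_cast at hb
      have h2 : t ^ (2*r+1) ≤ x ^ (2*r+1) := pow_le_pow_left₀ ht.le hc _
      have h3 := mul_le_mul_of_nonneg_right hb (by linarith : 0 ≤ x + t)
      have h4 := mul_le_mul_of_nonneg_left (by linarith : x + t ≤ 2 * x) (sub_nonneg.2 h2)
      have h5 : 0 < x * t ^ (2*r+1) := by positivity
      rw [pow_succ x (2*r+1)]
      nlinarith
    · have h3 : 0 ≤ (2 * r + 1) * t ^ (2*r) * (t^2 - x^2) := by
        have : 0 ≤ t^2 - x^2 := by nlinarith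
        positivity
      have h5 : 0 < x * t ^ (2*r+1) := by positivity
      have h6 : 0 < x ^ (2*r+2) := by positivity
      nlinarith
  have h7 := mul_pos ht key
  rw [mul_add, h, show t * (x+t)^2 * (x * TT x t (2*r+1)) =
    x * (t * (x+t)^2 * TT x t (2*r+1)) by ring, h']
  push_cast
  convert h7 using 1
  ring

lemma pair_nonneg {x t : ℝ} (hx : 0 < x) (ht : 0 < t) (r : ℕ) {a b : ℝ}
    (hb : 0 ≤ b) (hab : b ≤ x * a) :
    0 ≤ a * TT x t (2 * r + 2) + b * TT x t (2 * r + 1) ∧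
    (0 < a → 0 < a * TT x t (2 * r + 2) + b * TT x t (2 * r + 1)) := by
  have h1 := TT_pos hx ht r
  have h2 := TT_pair hx ht r
  have e : x * (a * TT x t (2 * r + 2) + b * TT x t (2 * r + 1)) =
    (x * a - b) * TT x t (2 * r + 2) + b * (TT x t (2 * r + 2) + x * TT x t (2 * r + 1)) := by ring
  have n1 := mul_nonneg (sub_nonneg.2 hab) h1.le
  have n2 := mul_nonneg hb h2.le
  constructor
  · refine nonneg_of_mul_nonneg_right (a := x) ?_ hx
    rw [e]; linarith
  · intro ha
    refine pos_of_mul_pos_right (a := x) ?_ hx.le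
    rw [e]
    rcases hb.eq_or_lt with h | h
    · have : 0 < (x * a - b) * TT x t (2 * r + 2) := by
        rw [← h, sub_zero]; positivity
      linarith
    · have := mul_pos h h2
      linarith

lemma sum_TT {x t : ℝ} (hx : 0 < x) (ht : 0 < t) (q : ℕ) : ∀ a : ℕ → ℝ, (∀ m, 0 ≤ a m) →
    (∀ m, a (m + 1) ≤ x * a m) →
    0 ≤ ∑ m ∈ Finset.range (2 * q), a m * TT x t (2 * q - m) ∧
    (0 < a 0 → 0 < q → 0 < ∑ m ∈ Finset.range (2 * q), a m * TT x t (2 * q - m)) := by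
  induction q with
  | zero => intro a _ _; simp
  | succ q ih =>
    intro a h0 h1
    have e : ∑ m ∈ Finset.range (2 * (q + 1)), a m * TT x t (2 * (q + 1) - m) =
      ∑ m ∈ Finset.range (2 * q), a (m + 2) * TT x t (2 * q - m) +
      (a 0 * TT x t (2 * q + 2) + a 1 * TT x t (2 * q + 1)) := by
      rw [show 2 * (q + 1) = 2 * q + 1 + 1 by ring, Finset.sum_range_succ', Finset.sum_range_succ']
      have : ∀ m, 2 * q + 1 + 1 - (m + 1 + 1) = 2 * q - m := fun m => by omega
      simp only [this]
      simp
      ring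
    have i := (ih (fun m => a (m + 2)) (fun m => h0 _) (fun m => h1 _)).1
    have p := pair_nonneg hx ht q (h0 1) (h1 0)
    rw [e]
    exact ⟨add_nonneg i p.1, fun ha _ => add_pos_of_nonneg_of_pos i (p.2 ha)⟩

/-- `Ψ(t)/t` -/
noncomputable def GG (n : ℕ) (a : ℕ → ℝ) (x t : ℝ) : ℝ :=
  ∑ m ∈ Finset.range n, a m *
    ∑ k ∈ Finset.range (n - m), (-1 : ℝ) ^ k * t ^ k * x ^ (n - m - 1 - k)

lemma Psi_eq (n : ℕ) (ω : Fin (n + 1) → ℕ) (d : ℤ) (t : ℝ) :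
    Psi n ω d t = t * GG n (esym ω) ((d : ℝ) - 1) t := by
  unfold Psi GG
  generalize (d : ℝ) - 1 = x
  have h := Finset.sum_range_diag_flip n
    (fun p q => (-1 : ℝ) ^ p * esym ω q * t ^ (p + 1) * x ^ (n - 1 - (p + q)))
  have e : ∀ j ∈ Finset.range n,
    (∑ k ∈ Finset.range (j + 1), (-1 : ℝ) ^ k * esym ω (j - k) * t ^ (k + 1)) *
      x ^ (n - 1 - j) = ∑ k ∈ Finset.range (j + 1), (-1 : ℝ) ^ k * esym ω (j - k) * t ^ (k + 1) *
      x ^ (n - 1 - (k + (j - k))) := by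
    intro j _
    rw [Finset.sum_mul]
    refine Finset.sum_congr rfl fun k hk => ?_
    have := Finset.mem_range.1 hk
    rw [show k + (j - k) = j by omega]
  rw [Finset.sum_congr rfl e, h, Finset.mul_sum]
  simp only [Finset.mul_sum]
  rw [Finset.sum_comm' (t' := Finset.range n) (s' := fun m => Finset.range (n - m))]
  · refine Finset.sum_congr rfl fun m hm => Finset.sum_congr rfl fun k hk => ?_
    rw [show n - m - 1 - k = n - 1 - (k + m) by omega]
    ring
  · intro a b
    simp only [Finset.mem_range]
    omega

lemma GG_deriv (n : ℕ) (a : ℕ → ℝ) (x t : ℝ) :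
    HasDerivAt (GG n a x) (-∑ m ∈ Finset.range n, a m * TT x t (n - m)) t := by
  unfold GG TT
  simp only [mul_neg, Finset.sum_neg_distrib, neg_neg]
  refine HasDerivAt.fun_sum fun m _ => HasDerivAt.const_mul _ ?_
  refine HasDerivAt.fun_sum fun k _ => HasDerivAt.mul_const ?_ _
  exact HasDerivAt.const_mul _ (hasDerivAt_pow k t)

theorem Psi_div_t_strictAnti_of_even (n : ℕ) (hn : 2 ≤ n) (heven : Even n)
    (ω : Fin (n + 1) → ℕ) (hω : ∀ i, 0 < ω i)
    (d : ℤ) (hd : (d : ℝ) ≥ esym ω 1 + 1) :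
    (∀ t : ℝ, 0 < t → t * deriv (Psi n ω d) t < Psi n ω d t) ∧
      StrictAntiOn (fun t => Psi n ω d t / t) (Set.Ioi (0 : ℝ)) := by
  have hes : ∀ k, esym ω k = esS ω Finset.univ k := fun k => rfl
  have hs1 : 0 < esym ω 1 := by
    unfold esym
    rw [Finset.powersetCard_one, Finset.sum_map]
    refine Finset.sum_pos (fun i _ => ?_) Finset.univ_nonempty
    simpa using hω i
  have hx1 : esym ω 1 ≤ (d : ℝ) - 1 := by linarith
  have hx : 0 < (d : ℝ) - 1 := by linarith
  have h0 : ∀ m, 0 ≤ esym ω m := fun m => by rw [hes]; exact esS_nonneg _ _ _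
  have hle : ∀ m, esym ω (m + 1) ≤ ((d : ℝ) - 1) * esym ω m := fun m =>
    le_trans (esS_succ_le ω Finset.univ m) (mul_le_mul_of_nonneg_right hx1 (h0 m))
  have hP : Psi n ω d = fun t => t * GG n (esym ω) ((d : ℝ) - 1) t := funext (Psi_eq n ω d)
  have hneg : ∀ t : ℝ, 0 < t →
      -∑ m ∈ Finset.range n, esym ω m * TT ((d : ℝ) - 1) t (n - m) < 0 := by
    intro t ht
    obtain ⟨q, hq⟩ := heven
    have hq' : n = 2 * q := by omega
    have := (sum_TT hx ht q (esym ω) h0 hle).2 (by rw [hes, esS_zero]; norm_num) (by omega)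
    rw [← hq'] at this
    linarith
  constructor
  · intro t ht
    have hd' := (hasDerivAt_id t).fun_mul (GG_deriv n (esym ω) ((d : ℝ) - 1) t)
    simp only [id] at hd'
    rw [hP, hd'.deriv]
    have := mul_neg_of_pos_of_neg (mul_pos ht ht) (hneg t ht)
    linarith
  · have hA : StrictAntiOn (GG n (esym ω) ((d : ℝ) - 1)) (Set.Ioi 0) := by
      refine strictAntiOn_of_deriv_neg (convex_Ioi 0)
        (fun t _ => (GG_deriv n _ _ t).continuousAt.continuousWithinAt) fun t ht => ?_
      rw [interior_Ioi] at ht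
      rw [(GG_deriv n _ _ t).deriv]
      exact hneg t ht
    refine hA.congr fun t ht => ?_
    have ht' : t ≠ 0 := ne_of_gt ht
    simp only [hP]
    field_simp
end

section
/- Suppose n ≥ 4 is even, d is an integer with d ≥ σ_1(ω) + 1, and α > 0 is the positive real root of x(x+1)^{n−1} = 2. Then Ψ(d − 1 + α·σ_1(ω)) < 0. -/
lemma aux_insert {ι : Type*} [DecidableEq ι] (w : ι → ℝ) (S : Finset ι) (a : ι) (ha : a ∉ S) (k : ℕ) :
    ∑ A ∈ Finset.powersetCard (k+1) (insert a S), ∏ i ∈ A, w i =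
    ∑ A ∈ Finset.powersetCard (k+1) S, ∏ i ∈ A, w i +
      w a * ∑ A ∈ Finset.powersetCard k S, ∏ i ∈ A, w i := by
  have hmem : ∀ A ∈ Finset.powersetCard k S, a ∉ A := fun A hA h =>
    ha ((Finset.mem_powersetCard.1 hA).1 h)
  rw [Finset.powersetCard_succ_insert ha, Finset.sum_union, Finset.sum_image, Finset.mul_sum]
  · congr 1
    refine Finset.sum_congr rfl fun A hA => ?_
    rw [Finset.prod_insert (hmem A hA)]
  · intro A hA B hB h
    have hA' := hmem A hA
    have hB' := hmem B hB
    have := congrArg (fun T => Finset.erase T a) h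
    simpa [Finset.erase_insert hA', Finset.erase_insert hB'] using this
  · rw [Finset.disjoint_left]
    intro A hA hA'
    obtain ⟨B, hB, rfl⟩ := Finset.mem_image.1 hA'
    exact ha ((Finset.mem_powersetCard.1 hA).1 (Finset.mem_insert_self a B))

lemma aux_newton {ι : Type*} [DecidableEq ι] (w : ι → ℝ) (hw : ∀ i, 0 ≤ w i) (S : Finset ι) :
    ∀ k : ℕ, ((k : ℝ) + 1) * ∑ A ∈ Finset.powersetCard (k+1) S, ∏ i ∈ A, w i ≤
      (∑ i ∈ S, w i) * ∑ A ∈ Finset.powersetCard k S, ∏ i ∈ A, w i := by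
  have hnn : ∀ (T : Finset ι) (k : ℕ), 0 ≤ ∑ A ∈ Finset.powersetCard k T, ∏ i ∈ A, w i :=
    fun T k => Finset.sum_nonneg fun A _ => Finset.prod_nonneg fun i _ => hw i
  induction S using Finset.induction_on with
  | empty =>
    intro k
    rw [Finset.powersetCard_eq_empty.2 (by simp)]
    simp
  | insert a S ha ih =>
    intro k
    rw [aux_insert w S a ha k, Finset.sum_insert ha]
    cases k with
    | zero =>
      have := ih 0
      simp at this ⊢
      nlinarith
    | succ k =>
      rw [aux_insert w S a ha k]
      have h1 := ih (k+1)
      have h2 := mul_le_mul_of_nonneg_left (ih k) (hw a)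
      have h3 := mul_nonneg (mul_nonneg (hw a) (hw a)) (hnn S k)
      push_cast at *
      nlinarith

lemma esym_one {N : ℕ} (ω : Fin N → ℕ) : esym ω 1 = ∑ i, (ω i : ℝ) := by
  simp [esym, Finset.powersetCard_one]

lemma esym_newton {N : ℕ} (ω : Fin N → ℕ) (k : ℕ) :
    ((k : ℝ) + 1) * esym ω (k+1) ≤ esym ω 1 * esym ω k := by
  rw [esym_one]
  exact aux_newton (fun i => (ω i : ℝ)) (fun i => Nat.cast_nonneg _) Finset.univ k

lemma esym_pos {N : ℕ} (ω : Fin N → ℕ) (hω : ∀ i, 0 < ω i) (k : ℕ) (hk : k ≤ N) : 0 < esym ω k := by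
  unfold esym
  apply Finset.sum_pos
  · intro A _
    exact Finset.prod_pos fun i _ => by exact_mod_cast hω i
  · apply Finset.powersetCard_nonempty.2
    simpa using hk

lemma c_eq (s : ℕ → ℝ) (t : ℝ) (n : ℕ) :
    ∑ k ∈ Finset.range (n + 1), (-1 : ℝ) ^ k * s (n - k) * t ^ (k + 1)
      = - ∑ i ∈ Finset.range (n+1), s i * (-t)^(n + 1 - i) := by
  rw [← Finset.sum_range_reflect, ← Finset.sum_neg_distrib]
  refine Finset.sum_congr rfl fun i hi => ?_
  have hi' : i ≤ n := by simpa [Nat.lt_succ_iff] using hi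
  obtain ⟨k, rfl⟩ := Nat.exists_eq_add_of_le hi'
  have e1 : i + k + 1 - 1 - i = k := by omega
  have e2 : i + k - k = i := by omega
  have e3 : i + k + 1 - i = k + 1 := by omega
  rw [e1, e2, e3, neg_pow t, pow_succ (-1 : ℝ)]
  ring

lemma R_succ (s : ℕ → ℝ) (x : ℝ) (n : ℕ) :
    ∑ i ∈ Finset.range (n+1), s i * x^(n + 1 - i)
      = x * (∑ i ∈ Finset.range n, s i * x^(n - i)) + s n * x := by
  rw [Finset.sum_range_succ, Finset.mul_sum]
  congr 1
  · refine Finset.sum_congr rfl fun i hi => ?_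
    have hi' := Finset.mem_range.1 hi
    rw [show n + 1 - i = (n - i) + 1 by omega, pow_succ]; ring
  · simp

lemma Q_eq (s : ℕ → ℝ) (D t : ℝ) (n : ℕ) :
    (D + t) * ∑ j ∈ Finset.range n,
    (∑ k ∈ Finset.range (j + 1), (-1 : ℝ) ^ k * s (j - k) * t ^ (k + 1)) * D ^ (n - 1 - j)
    = t * (∑ i ∈ Finset.range n, s i * D^(n - i) - ∑ i ∈ Finset.range n, s i * (-t)^(n - i)) := by
  induction n with
  | zero => simp
  | succ n ih =>
    have h : ∑ j ∈ Finset.range (n+1),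
      (∑ k ∈ Finset.range (j + 1), (-1 : ℝ) ^ k * s (j - k) * t ^ (k + 1)) * D ^ (n + 1 - 1 - j)
      = D * (∑ j ∈ Finset.range n,
      (∑ k ∈ Finset.range (j + 1), (-1 : ℝ) ^ k * s (j - k) * t ^ (k + 1)) * D ^ (n - 1 - j))
       + - ∑ i ∈ Finset.range (n+1), s i * (-t)^(n + 1 - i) := by
      rw [Finset.sum_range_succ, c_eq, Finset.mul_sum]
      congr 1
      · refine Finset.sum_congr rfl fun i hi => ?_
        have hi' := Finset.mem_range.1 hi
        rw [show n + 1 - 1 - i = (n - 1 - i) + 1 by omega, pow_succ]; ring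
      · simp
    rw [h, R_succ, R_succ, mul_add, mul_left_comm, ih]
    ring

lemma pair_sum (f : ℕ → ℝ) (p : ℕ) :
    ∑ i ∈ Finset.range (2 * p), f i = ∑ j ∈ Finset.range p, (f (2*j) + f (2*j+1)) := by
  induction p with
  | zero => simp
  | succ p ih =>
    rw [show 2 * (p+1) = 2*p+1+1 by ring, Finset.sum_range_succ, Finset.sum_range_succ, ih,
      Finset.sum_range_succ]
    ring

lemma ratio_pair (u v : ℝ) (hu : 1 ≤ u) (huv : u ≤ v) (a b : ℕ) :
    (v^a + v^b) * (1 + u^(a+b)) ≤ (u^a+u^b) * (1 + v^(a+b)) := by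
  have hv := hu.trans huv
  have h0 : 0 ≤ u := by linarith
  have h1 : u^a ≤ v^a := by gcongr
  have h2 : u^b ≤ v^b := by gcongr
  have h3 := one_le_pow₀ hu (n := a)
  have h4 := one_le_pow₀ hu (n := b)
  have h5 := one_le_pow₀ hv (n := a)
  have h6 := one_le_pow₀ hv (n := b)
  have h7 : 1 ≤ u^a*v^a := by nlinarith
  have h8 : 1 ≤ u^b*v^b := by nlinarith
  rw [pow_add, pow_add]
  nlinarith [mul_nonneg (sub_nonneg.2 h2) (sub_nonneg.2 h7),
    mul_nonneg (sub_nonneg.2 h1) (sub_nonneg.2 h8)]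

lemma ratio_sum (u v : ℝ) (hu : 1 ≤ u) (huv : u ≤ v) (N : ℕ) :
    (1 + u^N) * ∑ a ∈ Finset.range (N+1), v^a ≤ (1 + v^N) * ∑ a ∈ Finset.range (N+1), u^a := by
  have key : ∀ x : ℝ, 2 * ∑ a ∈ Finset.range (N+1), x^a
      = ∑ a ∈ Finset.range (N+1), (x^a + x^(N-a)) := by
    intro x
    rw [Finset.sum_add_distrib, two_mul]
    congr 1
    rw [← Finset.sum_range_reflect]
    simp
  have : (1 + u^N) * (2 * ∑ a ∈ Finset.range (N+1), v^a)
      ≤ (1 + v^N) * (2 * ∑ a ∈ Finset.range (N+1), u^a) := by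
    rw [key, key, Finset.mul_sum, Finset.mul_sum]
    refine Finset.sum_le_sum fun a ha => ?_
    have ha' := Finset.mem_range.1 ha
    have := ratio_pair u v hu huv a (N-a)
    rw [show a + (N - a) = N by omega] at this
    linarith
  linarith

/-- main reduction -/
lemma K_le (D s α c : ℝ) (N : ℕ) (hs : 0 < s) (hD : s ≤ D) (hα : 0 < α)
    (h : 1 + (1+α)^N ≤ c * ((1+α)^(N+1) - 1)) :
    s * (D^N + (D+α*s)^N) ≤ c * ((D+α*s)^(N+1) - D^(N+1)) := by
  have hD0 : 0 < D := by linarith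
  set u := (D+α*s)/D with hu
  have ht : D + α*s = D*u := by rw [hu]; field_simp
  have hu1 : u - 1 = α*s/D := by rw [hu]; field_simp; ring
  have hu1' : 1 ≤ u := by have : 0 ≤ α*s/D := by positivity
                          linarith
  have huv : u ≤ 1+α := by
    have : α*s/D ≤ α := by rw [div_le_iff₀ hD0]; nlinarith
    linarith
  have hr := ratio_sum u (1+α) hu1' huv N
  have gv := geom_sum_mul (1+α) (N+1)
  have gu := geom_sum_mul u (N+1)
  set V := ∑ a ∈ Finset.range (N+1), (1+α)^a
  set U := ∑ a ∈ Finset.range (N+1), u^a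
  have hV : 0 < V := Finset.sum_pos (fun a _ => by positivity) (by simp)
  have hU : 0 < U := Finset.sum_pos (fun a _ => by positivity) (by simp)
  have h2 : (1+u^N) * V ≤ (c * α * U) * V := by
    have : (1 + (1+α)^N) * U ≤ (c * (V * α)) * U := by
      apply mul_le_mul_of_nonneg_right _ hU.le
      rw [← gv] at h
      simpa using h
    linarith
  have h3 := le_of_mul_le_mul_right h2 hV
  rw [ht, mul_pow, mul_pow]
  have e : c * (D^(N+1) * u^(N+1) - D^(N+1)) = D^N * s * (c * α * U) := by
    rw [show D^(N+1) * u^(N+1) - D^(N+1) = D^(N+1) * (u^(N+1) - 1) by ring, ← gu, hu1, pow_succ]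
    field_simp
  rw [e]
  have := mul_le_mul_of_nonneg_left h3 (show 0 ≤ D^N * s by positivity)
  linarith

lemma alpha_lower (n : ℕ) (hn : 4 ≤ n) (heven : Even n) (α : ℝ) (hα : 0 < α)
    (hroot : α * (α + 1) ^ (n - 1) = 2) : 2 ≤ n * α := by
  by_contra! hlt
  have hn0 : (0:ℝ) < n := by positivity
  have hlt' : α < 2 / n := by rw [lt_div_iff₀ hn0]; linarith
  have hb : (2 / (n:ℝ) + 1)^(n-1) ≤ n := by
    rcases lt_or_ge n 8 with h | h
    · interval_cases n
      · norm_num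
      · norm_num
      · norm_num
      · norm_num
    · have h1 : (2 / (n:ℝ) + 1)^(n-1) ≤ (2 / (n:ℝ) + 1)^n := by
        apply pow_le_pow_right₀ _ (by omega)
        have : 0 < 2/(n:ℝ) := by positivity
        linarith
      have h2 : (2 / (n:ℝ) + 1)^n ≤ (Real.exp (2/n))^n :=
        pow_le_pow_left₀ (by positivity) (Real.add_one_le_exp _) n
      rw [← Real.exp_nat_mul, show (n:ℝ) * (2/n) = 1 + 1 by field_simp; norm_num, Real.exp_add] at h2
      have h3 := Real.exp_one_lt_d9
      have h4 := Real.exp_pos 1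
      have h5 : (8:ℝ) ≤ n := by exact_mod_cast h
      nlinarith
  have h1 : (α+1)^(n-1) ≤ (2/(n:ℝ)+1)^(n-1) := by gcongr
  have h2 : α * (α+1)^(n-1) < 2 / n * n :=
    mul_lt_mul hlt' (h1.trans hb) (by positivity) (by positivity)
  rw [hroot] at h2
  have : 2 / (n:ℝ) * n = 2 := by field_simp
  linarith

lemma v_strict (α : ℝ) (hα : 0 < α) (i N : ℕ) (hi : 2 ≤ i) (hN : 1 ≤ N)
    (h : 2 ≤ ((i + N + 1 : ℕ) : ℝ) * α) :
    ∃ c : ℝ, c < i + 1 ∧ 1 + (1+α)^N ≤ c * ((1+α)^(N+1) - 1) := by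
  have hi' : (2:ℝ) ≤ i := by exact_mod_cast hi
  have hN' : (1:ℝ) ≤ N := by exact_mod_cast hN
  have hb := one_add_mul_le_pow (show (-2:ℝ) ≤ α by linarith) N
  have hp : 0 < (1+α)^(N+1) - 1 := by
    have := one_lt_pow₀ (show 1 < 1+α by linarith) (show N+1 ≠ 0 by omega)
    linarith
  refine ⟨(1 + (1+α)^N) / ((1+α)^(N+1) - 1), ?_, ?_⟩
  · rw [div_lt_iff₀ hp, pow_succ]
    push_cast at h
    have h1 : ((i:ℝ) + (i+1)*α) * (1 + N*α) ≤ (i + (i+1)*α) * (1+α)^N :=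
      mul_le_mul_of_nonneg_left hb (by positivity)
    have h2 : 0 < (N:ℝ) * ((i:ℝ)-1) * α := by
      have : 0 < (i:ℝ) - 1 := by linarith
      positivity
    have h3 : 0 ≤ (i+1)*α*(N*α) := by positivity
    nlinarith
  · rw [div_mul_cancel₀ _ hp.ne']

theorem Psi_neg_of_even (n : ℕ) (hn : 4 ≤ n) (heven : Even n)
    (ω : Fin (n + 1) → ℕ) (hω : ∀ i, 0 < ω i)
    (d : ℤ) (hd : (d : ℝ) ≥ esym ω 1 + 1)
    (α : ℝ) (hα : 0 < α) (hroot : α * (α + 1) ^ (n - 1) = 2) :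
    Psi n ω d ((d : ℝ) - 1 + α * esym ω 1) < 0 := by
  have hal := alpha_lower n hn heven α hα hroot
  have hs : 0 < esym ω 1 := esym_pos ω hω 1 (by omega)
  have hD : esym ω 1 ≤ (d:ℝ) - 1 := by linarith
  unfold Psi
  generalize (d:ℝ) - 1 = D at hD ⊢
  have hD0 : 0 < D := by linarith
  have hQ := Q_eq (esym ω) D (D + α * esym ω 1) n
  have hK := fun c N => K_le D (esym ω 1) α c N hs hD hα
  set t := D + α * esym ω 1 with ht
  have htD : D < t := by have := mul_pos hα hs
                         linarith
  have ht0 : 0 < t := by linarith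
  suffices hneg : ∑ i ∈ Finset.range n, esym ω i * D^(n - i)
      - ∑ i ∈ Finset.range n, esym ω i * (-t)^(n - i) < 0 by
    have h := mul_neg_of_pos_of_neg ht0 hneg
    rw [← hQ] at h
    exact (pos_iff_neg_of_mul_neg h).1 (by linarith)
  obtain ⟨p, hp⟩ := heven
  have hp' : n = 2 * p := by omega
  rw [← Finset.sum_sub_distrib]
  have hterm : ∀ j < p, (esym ω (2*j) * D^(n - 2*j) - esym ω (2*j) * (-t)^(n-2*j))
      + (esym ω (2*j+1) * D^(n - (2*j+1)) - esym ω (2*j+1) * (-t)^(n-(2*j+1))) ≤ 0 ∧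
      (1 ≤ j → (esym ω (2*j) * D^(n - 2*j) - esym ω (2*j) * (-t)^(n-2*j))
      + (esym ω (2*j+1) * D^(n - (2*j+1)) - esym ω (2*j+1) * (-t)^(n-(2*j+1))) < 0) := by
    intro j hj
    obtain ⟨N, hN⟩ : ∃ N, n = 2*j + N + 1 := ⟨n - 2*j - 1, by omega⟩
    have hodd : Odd N := by
      rw [Nat.odd_iff]; omega
    have e1 : n - 2*j = N+1 := by omega
    have e2 : n - (2*j+1) = N := by omega
    rw [e1, e2, (hodd.add_one).neg_pow, hodd.neg_pow]
    have hnew := esym_newton ω (2*j)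
    have hi0 : 0 < esym ω (2*j) := esym_pos ω hω _ (by omega)
    have hX : 0 < D^N + t^N := by positivity
    have hY : 0 < t^(N+1) - D^(N+1) := by
      have : D^(N+1) < t^(N+1) := pow_lt_pow_left₀ htD hD0.le (by omega)
      linarith
    have hnew2 := mul_le_mul_of_nonneg_right hnew hX.le
    have hc0 : (0:ℝ) < ((2*j:ℕ):ℝ) + 1 := by positivity
    have strict : 1 ≤ j → (esym ω (2*j) * D^(N+1) - esym ω (2*j) * t^(N+1))
      + (esym ω (2*j+1) * D^N - esym ω (2*j+1) * -t^N) < 0 := by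
      intro hj1
      obtain ⟨c, hc, hc2⟩ := v_strict α hα (2*j) N (by omega) (by omega) (by rw [← hN]; exact hal)
      have h1 := mul_le_mul_of_nonneg_left (hK c N hc2) hi0.le
      have h2 := mul_lt_mul_of_pos_left (mul_lt_mul_of_pos_right hc hY) hi0
      have h3 : (((2*j:ℕ):ℝ) + 1) * ((esym ω (2*j) * D^(N+1) - esym ω (2*j) * t^(N+1))
        + (esym ω (2*j+1) * D^N - esym ω (2*j+1) * -t^N)) < 0 := by linarith
      exact (pos_iff_neg_of_mul_neg h3).1 hc0
    refine ⟨?_, strict⟩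
    rcases Nat.eq_zero_or_pos j with rfl | hj1
    · have hNn : n - 1 = N := by omega
      rw [hNn] at hroot
      have h1 := hK 1 N (by rw [pow_succ, add_comm 1 α]; linarith)
      have h0 : esym ω 0 = 1 := by simp [esym]
      simp only [mul_zero, zero_add, h0]
      linarith
    · exact (strict hj1).le
  have hps := pair_sum (fun i => esym ω i * D^(n - i) - esym ω i * (-t)^(n - i)) p
  rw [← hp'] at hps
  rw [hps]
  apply Finset.sum_neg' 
  · intro j hj
    exact (hterm j (Finset.mem_range.1 hj)).1
  · exact ⟨1, Finset.mem_range.2 (by omega), (hterm 1 (by omega)).2 le_rfl⟩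
end
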